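/- Let r ≥ 1, δ ≥ 0 and Φ(t) = t^r (1+log⁺ t)^δ. Let v be a weight with v^r ∈ A₁. Then there exists a constant C > 0 such that v(x) ≤ M_Φ v(x) ≤ C v(x) for almost every x ∈ ℝ^n. -/

import Mathlib

open MeasureTheory ENNReal Set

noncomputable section

/-- The axis-parallel half-open cube with corner `a` and side length `h`. -/
def cube (n : ℕ) (a : Fin n → ℝ) (h : ℝ) : Set (Fin n → ℝ) :=
  {x | ∀ i, a i ≤ x i ∧ x i < a i + h}

/-- A cube in `ℝ^n` with sides parallel to the coordinate axes. -/
def IsCube {n : ℕ} (Q : Set (Fin n → ℝ)) : Prop :=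
  ∃ a h, 0 < h ∧ Q = cube n a h

/-- A Young function: convex, increasing on `[0,∞)`, vanishing at `0`, tending to `∞`. -/
def IsYoung (φ : ℝ → ℝ) : Prop :=
  ConvexOn ℝ (Ici 0) φ ∧ MonotoneOn φ (Ici 0) ∧ φ 0 = 0 ∧
    Filter.Tendsto φ Filter.atTop Filter.atTop

/-- The Luxemburg average `‖f‖_{φ,Q}`. -/
def luxNorm {n : ℕ} (φ : ℝ → ℝ) (f : (Fin n → ℝ) → ℝ) (Q : Set (Fin n → ℝ)) : ℝ :=
  sInf {l : ℝ | 0 < l ∧ ∫ y in Q, φ (|f y| / l) ≤ (volume Q).toReal}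

/-- The generalized maximal operator `M_φ f`. -/
def maximalOp {n : ℕ} (φ : ℝ → ℝ) (f : (Fin n → ℝ) → ℝ) (x : Fin n → ℝ) : ℝ≥0∞ :=
  ⨆ (Q : Set (Fin n → ℝ)) (_ : IsCube Q ∧ x ∈ Q), ENNReal.ofReal (luxNorm φ f Q)

/-- The generalized fractional maximal operator `M_{γ,φ} f`. -/
def fracMaximalOp {n : ℕ} (γ : ℝ) (φ : ℝ → ℝ) (f : (Fin n → ℝ) → ℝ) (x : Fin n → ℝ) : ℝ≥0∞ :=
  ⨆ (Q : Set (Fin n → ℝ)) (_ : IsCube Q ∧ x ∈ Q),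
    (volume Q) ^ (γ / (n : ℝ)) * ENNReal.ofReal (luxNorm φ f Q)

/-- A weight: locally integrable, positive (and finite) a.e. -/
def IsWeight {n : ℕ} (w : (Fin n → ℝ) → ℝ) : Prop :=
  LocallyIntegrable w volume ∧ ∀ᵐ x ∂(volume : Measure (Fin n → ℝ)), 0 < w x

/-- The Muckenhoupt `A₁` class. -/
def MuckenhouptA1 {n : ℕ} (w : (Fin n → ℝ) → ℝ) : Prop :=
  IsWeight w ∧ ∃ C > 0, ∀ Q : Set (Fin n → ℝ), IsCube Q →
    ∫ x in Q, w x ≤ C * essInf w (volume.restrict Q) * (volume Q).toReal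

/-- The Muckenhoupt `A_∞` class, via the `∫_E w ≤ C (|E|/|Q|)^ε ∫_Q w` characterization. -/
def MuckenhouptAinfty {n : ℕ} (w : (Fin n → ℝ) → ℝ) : Prop :=
  IsWeight w ∧ ∃ C > 0, ∃ ε > 0, ∀ Q : Set (Fin n → ℝ), IsCube Q →
    ∀ E ⊆ Q, MeasurableSet E →
      ∫ x in E, w x ≤ C * ((volume E).toReal / (volume Q).toReal) ^ ε * ∫ x in Q, w x

/-- The reverse Hölder class `RH_s`. -/
def MemRH {n : ℕ} (s : ℝ) (w : (Fin n → ℝ) → ℝ) : Prop :=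
  IsWeight w ∧ ∃ C > 0, ∀ Q : Set (Fin n → ℝ), IsCube Q →
    ((∫ x in Q, w x ^ s) / (volume Q).toReal) ^ (1 / s) ≤
      C * ((∫ x in Q, w x) / (volume Q).toReal)

/-- A submultiplicative function: `φ(st) ≤ C φ(s) φ(t)`. -/
def Submultiplicative (φ : ℝ → ℝ) : Prop :=
  ∃ C > 0, ∀ s t : ℝ, 0 ≤ s → 0 ≤ t → φ (s * t) ≤ C * φ s * φ t

/-- `φ` has lower type `r`: `φ(st) ≤ C s^r φ(t)` for `0 < s ≤ 1`, `t > 0`. -/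
def HasLowerType (r : ℝ) (φ : ℝ → ℝ) : Prop :=
  ∃ C > 0, ∀ s t : ℝ, 0 < s → s ≤ 1 → 0 < t → φ (s * t) ≤ C * s ^ r * φ t

/-- The family `𝔉_r` of Young functions. -/
def MemFr (r : ℝ) (φ : ℝ → ℝ) : Prop :=
  IsYoung φ ∧ Submultiplicative φ ∧ HasLowerType r φ ∧
    ∃ C₀ > 0, ∃ δ : ℝ, 0 ≤ δ ∧ ∃ tstar : ℝ, 1 ≤ tstar ∧
      ∀ t : ℝ, tstar ≤ t → φ t ≤ C₀ * (Real.log t) ^ δ * t ^ r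

/-- `log⁺ t = max {0, log t}`. -/
def logPlus (t : ℝ) : ℝ := max 0 (Real.log t)

/-- A dyadic grid in `ℝ^n`. -/
def IsDyadicGrid {n : ℕ} (D : Set (Set (Fin n → ℝ))) : Prop :=
  (∀ Q ∈ D, ∃ (a : Fin n → ℝ) (k : ℤ), Q = cube n a ((2 : ℝ) ^ k)) ∧
  (∀ Q ∈ D, ∀ P ∈ D, (Q ∩ P).Nonempty → Q ⊆ P ∨ P ⊆ Q) ∧
  (∀ k : ℤ, ⋃₀ {Q | Q ∈ D ∧ ∃ a, Q = cube n a ((2 : ℝ) ^ k)} = univ)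

/-- The dyadic maximal operator `M_{φ,𝒟} f`. -/
def dyadicMaximalOp {n : ℕ} (D : Set (Set (Fin n → ℝ))) (φ : ℝ → ℝ)
    (f : (Fin n → ℝ) → ℝ) (x : Fin n → ℝ) : ℝ≥0∞ :=
  ⨆ (Q : Set (Fin n → ℝ)) (_ : Q ∈ D ∧ x ∈ Q), ENNReal.ofReal (luxNorm φ f Q)

/-- The generalized inverse `φ⁻¹(t) = inf {s ≥ 0 : φ(s) ≥ t}`, with `inf ∅ = ∞`. -/
def genInv (φ : ℝ → ℝ) (t : ℝ) : ℝ≥0∞ :=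
  ⨅ (s : ℝ) (_ : 0 ≤ s ∧ t ≤ φ s), ENNReal.ofReal s

end

open Filter Topology

lemma cube_eq_pi (n : ℕ) (a : Fin n → ℝ) (h : ℝ) :
    cube n a h = Set.pi univ fun i => Ico (a i) (a i + h) := by
  ext x; simp [cube]

lemma measurableSet_cube (n : ℕ) (a : Fin n → ℝ) (h : ℝ) : MeasurableSet (cube n a h) := by
  rw [cube_eq_pi]
  exact MeasurableSet.univ_pi fun i => measurableSet_Ico

lemma volume_cube (n : ℕ) (a : Fin n → ℝ) (h : ℝ) :
    volume (cube n a h) = ENNReal.ofReal h ^ n := by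
  simp [cube_eq_pi, Real.volume_pi_Ico]

lemma isCube_cube (n : ℕ) (a : Fin n → ℝ) {h : ℝ} (hh : 0 < h) : IsCube (cube n a h) :=
  ⟨a, h, hh, rfl⟩

lemma cube_ae_eq_closedBall (n : ℕ) (a : Fin n → ℝ) {h : ℝ} (hh : 0 < h) :
    cube n a h =ᵐ[volume] Metric.closedBall (fun i => a i + h / 2) (h / 2) := by
  have h1 : Metric.closedBall (fun i => a i + h / 2) (h / 2)
      = Icc a (fun i => a i + h) := by
    rw [closedBall_pi _ (by positivity), ← pi_univ_Icc]
    refine pi_congr rfl fun i _ => ?_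
    rw [Real.closedBall_eq_Icc]
    congr 1 <;> ring
  rw [cube_eq_pi, h1]
  exact Measure.univ_pi_Ico_ae_eq_Icc

lemma cube_subset_closedBall (n : ℕ) (a : Fin n → ℝ) {h : ℝ} (hh : 0 < h) :
    cube n a h ⊆ Metric.closedBall (fun i => a i + h / 2) (h / 2) := by
  intro x hx
  rw [Metric.mem_closedBall, dist_pi_le_iff (by positivity)]
  intro i
  rw [Real.dist_eq, abs_le]
  constructor <;> linarith [(hx i).1, (hx i).2]

namespace IsCube

variable {n : ℕ} {Q : Set (Fin n → ℝ)}

lemma measurableSet (hQ : IsCube Q) : MeasurableSet Q := by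
  obtain ⟨a, h, -, rfl⟩ := hQ
  exact measurableSet_cube n a h

lemma volume_ne_zero (hQ : IsCube Q) : volume Q ≠ 0 := by
  obtain ⟨a, h, hh, rfl⟩ := hQ
  rw [volume_cube]
  exact pow_ne_zero _ (by simpa using hh)

lemma volume_ne_top (hQ : IsCube Q) : volume Q ≠ ∞ := by
  obtain ⟨a, h, hh, rfl⟩ := hQ
  rw [volume_cube]
  exact pow_ne_top ofReal_ne_top

lemma integrableOn (hQ : IsCube Q) {w : (Fin n → ℝ) → ℝ} (hw : LocallyIntegrable w volume) :
    IntegrableOn w Q volume := by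
  obtain ⟨a, h, hh, rfl⟩ := hQ
  exact (hw.integrableOn_isCompact (isCompact_closedBall _ _)).mono_set
    (cube_subset_closedBall n a hh)

lemma lintegral_ne_top (hQ : IsCube Q) {w : (Fin n → ℝ) → ℝ}
    (hw : LocallyIntegrable w volume) : ∫⁻ y in Q, ENNReal.ofReal (w y) ≠ ∞ :=
  (hQ.integrableOn hw).lintegral_lt_top.ne

end IsCube

/-- Lebesgue differentiation along arbitrary cubes shrinking to the point. -/
lemma IsWeight.ae_tendsto_average {n : ℕ} {w : (Fin n → ℝ) → ℝ} (hw : IsWeight w) :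
    ∀ᵐ x ∂(volume : Measure (Fin n → ℝ)), ∀ (a : ℕ → Fin n → ℝ) (h : ℕ → ℝ),
      (∀ k, 0 < h k) → Tendsto h atTop (𝓝 0) → (∀ k, x ∈ cube n (a k) (h k)) →
      Tendsto (fun k => (∫⁻ y in cube n (a k) (h k), ENNReal.ofReal (w y)) /
        volume (cube n (a k) (h k))) atTop (𝓝 (ENNReal.ofReal (w x))) := by
  filter_upwards [IsUnifLocDoublingMeasure.ae_tendsto_average volume hw.1 1] with x hx a h hh h0 hxa
  have h1 : Tendsto (fun k => h k / 2) atTop (𝓝[>] 0) := by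
    rw [tendsto_nhdsWithin_iff]
    exact ⟨by simpa using h0.div_const 2, Eventually.of_forall fun k => half_pos (hh k)⟩
  have h2 := hx (fun k i => a k i + h k / 2) (fun k => h k / 2) h1
    (Eventually.of_forall fun k => by
      simpa using cube_subset_closedBall n (a k) (hh k) (hxa k))
  refine (ENNReal.tendsto_ofReal h2).congr fun k => ?_
  rw [← ofReal_setAverage ((isCube_cube n (a k) (hh k)).integrableOn hw.1)
    (ae_restrict_of_ae (hw.2.mono fun y hy => hy.le))]
  rw [setAverage_eq, setAverage_eq, setIntegral_congr_set (cube_ae_eq_closedBall n (a k) (hh k)),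
    measureReal_congr (cube_ae_eq_closedBall n (a k) (hh k))]

/-- The `k`-th generation dyadic subcube, relative to the grid generated by `cube n a h`,
that contains `x`. -/
def dyadicCell {n : ℕ} (a : Fin n → ℝ) (h : ℝ) (k : ℕ) (x : Fin n → ℝ) : Set (Fin n → ℝ) :=
  {y | ∀ i, ⌊(y i - a i) / h * 2 ^ k⌋ = ⌊(x i - a i) / h * 2 ^ k⌋}

namespace dyadicCell

variable {n : ℕ} {a : Fin n → ℝ} {h : ℝ} {k j : ℕ} {x y : Fin n → ℝ}

lemma mem_self : x ∈ dyadicCell a h k x := fun _ => rfl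

lemma eq_cube (hh : 0 < h) : dyadicCell a h k x =
    cube n (fun i => a i + h / 2 ^ k * ⌊(x i - a i) / h * 2 ^ k⌋) (h / 2 ^ k) := by
  ext y
  refine forall_congr' fun i => ?_
  rw [Int.floor_eq_iff]
  have h2 : (0 : ℝ) < h / 2 ^ k := by positivity
  have h3 : y i = a i + h / 2 ^ k * ((y i - a i) / h * 2 ^ k) := by field_simp; ring
  generalize (y i - a i) / h * 2 ^ k = u at *
  rw [h3, add_le_add_iff_left, mul_le_mul_iff_right₀ h2, add_assoc, add_lt_add_iff_left,
    ← mul_add_one, mul_lt_mul_iff_right₀ h2]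

lemma isCube (hh : 0 < h) : IsCube (dyadicCell a h k x) :=
  ⟨_, _, by positivity, eq_cube hh⟩

lemma eq_of_mem (hy : y ∈ dyadicCell a h k x) : dyadicCell a h k y = dyadicCell a h k x := by
  ext z
  exact forall_congr' fun i => by rw [hy i]

lemma succ_subset : dyadicCell a h (k + 1) x ⊆ dyadicCell a h k x := by
  intro y hy i
  have key : ∀ u : ℝ, ⌊u * 2 ^ k⌋ = ⌊u * 2 ^ (k + 1)⌋ / 2 := fun u => by
    have h2 := Int.floor_div_natCast (u * 2 ^ (k + 1)) 2
    rw [Nat.cast_ofNat, Nat.cast_ofNat, pow_succ, ← mul_assoc,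
      mul_div_cancel_right₀ _ two_ne_zero] at h2
    rw [h2, pow_succ, mul_assoc]
  rw [key, key, hy i]

lemma antitone : Antitone fun k => dyadicCell a h k x :=
  antitone_nat_of_succ_le fun _ => succ_subset

lemma eq_of_mem_of_le (hy : y ∈ dyadicCell a h k x) (hjk : j ≤ k) :
    dyadicCell a h j y = dyadicCell a h j x :=
  eq_of_mem (antitone hjk hy)

lemma zero_eq (hh : 0 < h) (hx : x ∈ cube n a h) : dyadicCell a h 0 x = cube n a h := by
  rw [eq_cube hh]
  have : ∀ i, ⌊(x i - a i) / h * 2 ^ 0⌋ = 0 := fun i => by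
    rw [Int.floor_eq_zero_iff]
    have := hx i
    constructor
    · rw [pow_zero, mul_one]
      exact div_nonneg (by linarith) hh.le
    · rw [pow_zero, mul_one, div_lt_one hh]
      linarith
  simp only [this]
  simp

lemma volume_eq_succ (hh : 0 < h) :
    volume (dyadicCell a h k x) = 2 ^ n * volume (dyadicCell a h (k + 1) x) := by
  rw [eq_cube hh, eq_cube hh, volume_cube, volume_cube, ← mul_pow]
  congr 1
  rw [← ENNReal.ofReal_ofNat 2, ← ENNReal.ofReal_mul (by norm_num)]
  congr 1
  rw [pow_succ]
  field_simp

lemma countable_cells (a : Fin n → ℝ) (h : ℝ) :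
    {P | ∃ k x, P = dyadicCell a h k x}.Countable := by
  refine (Set.countable_range (fun p : ℕ × (Fin n → ℤ) =>
    {y : Fin n → ℝ | ∀ i, ⌊(y i - a i) / h * 2 ^ p.1⌋ = p.2 i})).mono ?_
  rintro P ⟨k, x, rfl⟩
  exact ⟨(k, fun i => ⌊(x i - a i) / h * 2 ^ k⌋), rfl⟩

end dyadicCell

/-- The Calderón–Zygmund decomposition of a cube at height `t`. -/
lemma IsWeight.exists_calderonZygmund {n : ℕ} {w : (Fin n → ℝ) → ℝ} (hw : IsWeight w)
    {Q : Set (Fin n → ℝ)} (hQ : IsCube Q) {t : ℝ≥0∞}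
    (ht : ∫⁻ y in Q, ENNReal.ofReal (w y) ≤ t * volume Q) :
    ∃ S : Set (Set (Fin n → ℝ)), S.Countable ∧ S.PairwiseDisjoint id ∧
      (∀ P ∈ S, IsCube P ∧ P ⊆ Q ∧ t * volume P ≤ ∫⁻ y in P, ENNReal.ofReal (w y) ∧
        ∫⁻ y in P, ENNReal.ofReal (w y) ≤ 2 ^ n * t * volume P) ∧
      ∀ᵐ x, x ∈ Q → x ∉ ⋃ P ∈ S, P → ENNReal.ofReal (w x) ≤ t := by
  obtain ⟨a, h, hh, rfl⟩ := hQ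
  let big : Set (Fin n → ℝ) → Prop := fun P => t * volume P < ∫⁻ y in P, ENNReal.ofReal (w y)
  refine ⟨{P | ∃ k, ∃ x ∈ cube n a h, P = dyadicCell a h k x ∧ big (dyadicCell a h k x) ∧
    ∀ j < k, ¬ big (dyadicCell a h j x)}, ?_, ?_, ?_, ?_⟩
  · refine (dyadicCell.countable_cells a h).mono ?_
    rintro P ⟨k, x, -, hP, -⟩
    exact ⟨k, x, hP⟩
  · rintro _ ⟨k, x, -, rfl, hb, hm⟩ _ ⟨k', x', -, rfl, hb', hm'⟩ hne
    refine disjoint_left.2 fun y hy hy' => hne ?_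
    simp only [id] at hy hy' ⊢
    rcases lt_trichotomy k k' with hlt | rfl | hlt
    · exact absurd hb (by
        rw [← dyadicCell.eq_of_mem hy, dyadicCell.eq_of_mem_of_le hy' hlt.le]
        exact hm' k hlt)
    · rw [← dyadicCell.eq_of_mem hy, dyadicCell.eq_of_mem hy']
    · exact absurd hb' (by
        rw [← dyadicCell.eq_of_mem hy', dyadicCell.eq_of_mem_of_le hy hlt.le]
        exact hm k' hlt)
  · rintro _ ⟨k, x, hx, rfl, hb, hm⟩
    refine ⟨dyadicCell.isCube hh, ?_, hb.le, ?_⟩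
    · rw [← dyadicCell.zero_eq hh hx]
      exact dyadicCell.antitone (Nat.zero_le k)
    · cases k with
      | zero =>
        rw [dyadicCell.zero_eq hh hx] at hb
        exact absurd hb ht.not_gt
      | succ k =>
        calc ∫⁻ y in dyadicCell a h (k + 1) x, ENNReal.ofReal (w y)
            ≤ ∫⁻ y in dyadicCell a h k x, ENNReal.ofReal (w y) :=
              lintegral_mono_set dyadicCell.succ_subset
          _ ≤ t * volume (dyadicCell a h k x) := not_lt.1 (hm k k.lt_succ_self)
          _ = _ := by rw [dyadicCell.volume_eq_succ hh]; ring
  · filter_upwards [hw.ae_tendsto_average] with x hx hxQ hxS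
    have hsmall : ∀ k, ¬ big (dyadicCell a h k x) := by
      classical
      by_contra! hex
      refine hxS (mem_biUnion ⟨Nat.find hex, x, hxQ, rfl, Nat.find_spec hex, fun j hj =>
        Nat.find_min hex hj⟩ dyadicCell.mem_self)
    have hlim := hx (fun k i => a i + h / 2 ^ k * ⌊(x i - a i) / h * 2 ^ k⌋) (fun k => h / 2 ^ k)
      (fun k => by positivity) (by
        have := (tendsto_pow_atTop_nhds_zero_of_lt_one (r := (1 / 2 : ℝ)) (by norm_num)
          (by norm_num)).const_mul h
        simpa [div_eq_mul_inv] using this)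
      (fun k => by rw [← dyadicCell.eq_cube hh]; exact dyadicCell.mem_self)
    refine le_of_tendsto' hlim fun k => ?_
    rw [← dyadicCell.eq_cube hh]
    exact ENNReal.div_le_of_le_mul (not_lt.1 (hsmall k))

lemma MuckenhouptA1.exists_ae_le {n : ℕ} {w : (Fin n → ℝ) → ℝ} (hw : MuckenhouptA1 w) :
    ∃ A : ℝ, 1 ≤ A ∧ ∀ Q : Set (Fin n → ℝ), IsCube Q → ∀ᵐ y ∂volume.restrict Q,
      ∫⁻ z in Q, ENNReal.ofReal (w z) ≤ ENNReal.ofReal A * ENNReal.ofReal (w y) * volume Q := by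
  obtain ⟨hw, C, hC, hA⟩ := hw
  refine ⟨max C 1, le_max_right _ _, fun Q hQ => ?_⟩
  have hpos : ∀ᵐ y ∂volume.restrict Q, 0 ≤ w y := ae_restrict_of_ae (hw.2.mono fun y hy => hy.le)
  filter_upwards [ae_essInf_le (f := w) (μ := volume.restrict Q) ⟨0, by simpa using hpos⟩, hpos]
    with y hy hy0
  rw [← ofReal_integral_eq_lintegral_ofReal (hQ.integrableOn hw.1) hpos,
    ← ENNReal.ofReal_toReal hQ.volume_ne_top, ← ENNReal.ofReal_mul (by positivity),
    ← ENNReal.ofReal_mul (by positivity)]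
  refine ENNReal.ofReal_le_ofReal ((hA Q hQ).trans ?_)
  refine mul_le_mul_of_nonneg_right ?_ ENNReal.toReal_nonneg
  exact (mul_le_mul_of_nonneg_left hy hC.le).trans
    (mul_le_mul_of_nonneg_right (le_max_left _ _) hy0)

lemma IsWeight.lintegral_cube_ne_zero {n : ℕ} {w : (Fin n → ℝ) → ℝ} (hw : IsWeight w)
    {Q : Set (Fin n → ℝ)} (hQ : IsCube Q) : ∫⁻ y in Q, ENNReal.ofReal (w y) ≠ 0 := by
  intro h0
  rw [lintegral_eq_zero_iff' (hQ.integrableOn hw.1).1.aemeasurable.ennreal_ofReal] at h0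
  have : ∀ᵐ y ∂volume.restrict Q, False := by
    filter_upwards [h0, ae_restrict_of_ae hw.2] with y hy hy'
    simp only [Pi.zero_apply, ENNReal.ofReal_eq_zero] at hy
    linarith
  rw [eventually_false_iff_eq_bot, ae_eq_bot, Measure.restrict_eq_zero] at this
  exact hQ.volume_ne_zero this

/-- For an `A₁` weight, the Calderón–Zygmund cubes at twice the mean of the weight miss a fixed
proportion of the mass. -/
lemma lintegral_le_of_calderonZygmund {n : ℕ} {w : (Fin n → ℝ) → ℝ} (hw : IsWeight w)
    {A : ℝ} (hA1 : 1 ≤ A) {Q : Set (Fin n → ℝ)} (hQ : IsCube Q)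
    (hA : ∀ᵐ y ∂volume.restrict Q,
      ∫⁻ z in Q, ENNReal.ofReal (w z) ≤ ENNReal.ofReal A * ENNReal.ofReal (w y) * volume Q)
    {O : Set (Fin n → ℝ)} (hOQ : O ⊆ Q) (hOm : MeasurableSet O)
    (hO : 2 * ((∫⁻ z in Q, ENNReal.ofReal (w z)) / volume Q) * volume O ≤
      ∫⁻ z in O, ENNReal.ofReal (w z)) :
    ∫⁻ z in O, ENNReal.ofReal (w z) ≤
      ENNReal.ofReal (1 - 1 / (2 * A)) * ∫⁻ z in Q, ENNReal.ofReal (w z) := by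
  have hI0 := hw.lintegral_cube_ne_zero hQ
  have hIt := hQ.lintegral_ne_top hw.1
  have hV0 := hQ.volume_ne_zero
  have hVt := hQ.volume_ne_top
  have hsplit := lintegral_inter_add_sdiff (μ := volume) (fun z => ENNReal.ofReal (w z)) Q hOm
  have hvol := measure_inter_add_sdiff (μ := volume) Q hOm
  rw [inter_eq_self_of_subset_right hOQ] at hsplit hvol
  have hJ : (∫⁻ z in Q, ENNReal.ofReal (w z)) * volume (Q \ O) ≤
      ENNReal.ofReal A * volume Q * ∫⁻ z in Q \ O, ENNReal.ofReal (w z) := by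
    rw [← setLIntegral_const, ← lintegral_const_mul' _ _ (by finiteness)]
    refine lintegral_mono_ae ?_
    filter_upwards [ae_restrict_of_ae_restrict_of_subset sdiff_subset hA] with y hy
    exact hy.trans_eq (by ring)
  have hJt : ∫⁻ z in Q \ O, ENNReal.ofReal (w z) ≠ ∞ :=
    ne_top_of_le_ne_top hIt (lintegral_mono_set sdiff_subset)
  have hKt : ∫⁻ z in O, ENNReal.ofReal (w z) ≠ ∞ :=
    ne_top_of_le_ne_top hIt (lintegral_mono_set hOQ)
  have hOt : volume O ≠ ∞ := ne_top_of_le_ne_top hVt (measure_mono hOQ)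
  have hDt : volume (Q \ O) ≠ ∞ := ne_top_of_le_ne_top hVt (measure_mono sdiff_subset)
  generalize (∫⁻ z in Q, ENNReal.ofReal (w z)) = I at *
  generalize (∫⁻ z in O, ENNReal.ofReal (w z)) = K at *
  generalize (∫⁻ z in Q \ O, ENNReal.ofReal (w z)) = J at *
  generalize volume Q = V at *
  generalize volume (Q \ O) = D at *
  generalize volume O = U at *
  lift I to NNReal using hIt
  lift K to NNReal using hKt
  lift J to NNReal using hJt
  lift V to NNReal using hVt
  lift D to NNReal using hDt
  lift U to NNReal using hOt
  have hV : (0 : ℝ) < V := by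
    have : V ≠ 0 := by simpa using hV0
    positivity
  have hI : (0 : ℝ) < I := by
    have : I ≠ 0 := by simpa using hI0
    positivity
  have e1 : (K : ℝ) + J = I := by exact_mod_cast hsplit
  have e2 : (U : ℝ) + D = V := by exact_mod_cast hvol
  have e3 : (I : ℝ) * D ≤ A * V * J := by
    have := ENNReal.toReal_mono (by finiteness) hJ
    simpa [ENNReal.toReal_ofReal (zero_le_one.trans hA1)] using this
  have e4 : 2 * ((I : ℝ) / V) * U ≤ K := by
    have := ENNReal.toReal_mono (by finiteness) hO
    simpa using this
  have hKI : (K : ℝ) ≤ I := by linarith [J.coe_nonneg]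
  have e5 : 2 * (U : ℝ) ≤ V := by
    have : 2 * ((I : ℝ) / V) * U * V = 2 * I * U := by field_simp
    nlinarith
  have e6 : (I : ℝ) ≤ 2 * A * J := by
    have h1 : (I : ℝ) * V ≤ 2 * A * J * V := by nlinarith
    exact le_of_mul_le_mul_right h1 hV
  have hA0 : 0 < A := by linarith
  have e7 : (K : ℝ) ≤ (1 - 1 / (2 * A)) * I := by
    have : 1 / (2 * A) * (I : ℝ) ≤ J := by
      rw [div_mul_eq_mul_div, one_mul, div_le_iff₀ (by positivity)]
      linarith
    linarith
  rw [← ENNReal.ofReal_coe_nnreal, ← ENNReal.ofReal_coe_nnreal (p := I),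
    ← ENNReal.ofReal_mul (sub_nonneg.2 (by rw [div_le_one (by positivity)]; linarith))]
  exact ENNReal.ofReal_le_ofReal e7

/-- The mean of `w` over `Q`. -/
noncomputable def cubeMean {n : ℕ} (w : (Fin n → ℝ) → ℝ) (Q : Set (Fin n → ℝ)) : ℝ≥0∞ :=
  (∫⁻ y in Q, ENNReal.ofReal (w y)) / volume Q

lemma IsWeight.cubeMean_ne_zero {n : ℕ} {w : (Fin n → ℝ) → ℝ} (hw : IsWeight w)
    {Q : Set (Fin n → ℝ)} (hQ : IsCube Q) : cubeMean w Q ≠ 0 :=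
  ENNReal.div_ne_zero.2 ⟨hw.lintegral_cube_ne_zero hQ, hQ.volume_ne_top⟩

lemma IsWeight.cubeMean_ne_top {n : ℕ} {w : (Fin n → ℝ) → ℝ} (hw : IsWeight w)
    {Q : Set (Fin n → ℝ)} (hQ : IsCube Q) : cubeMean w Q ≠ ∞ :=
  ENNReal.div_ne_top (hQ.lintegral_ne_top hw.1) hQ.volume_ne_zero

lemma IsCube.cubeMean_mul_volume {n : ℕ} {Q : Set (Fin n → ℝ)} (hQ : IsCube Q)
    (w : (Fin n → ℝ) → ℝ) : cubeMean w Q * volume Q = ∫⁻ y in Q, ENNReal.ofReal (w y) :=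
  ENNReal.div_mul_cancel hQ.volume_ne_zero hQ.volume_ne_top

/-- The truncated integral `∫_Q w min((w / w_Q)^ε, N)`. -/
noncomputable def truncIntegral {n : ℕ} (w : (Fin n → ℝ) → ℝ) (ε : ℝ) (N : ℕ) (Q : Set (Fin n → ℝ)) : ℝ≥0∞ :=
  ∫⁻ y in Q, ENNReal.ofReal (w y) * min ((ENNReal.ofReal (w y) / cubeMean w Q) ^ ε) N

/-- One Calderón–Zygmund step for the truncated integral. -/
lemma truncIntegral_le {n : ℕ} {w : (Fin n → ℝ) → ℝ} (hw : IsWeight w)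
    {A : ℝ} (hA1 : 1 ≤ A) {Q : Set (Fin n → ℝ)} (hQ : IsCube Q)
    (hA : ∀ᵐ y ∂volume.restrict Q,
      ∫⁻ z in Q, ENNReal.ofReal (w z) ≤ ENNReal.ofReal A * ENNReal.ofReal (w y) * volume Q)
    {ε : ℝ} (hε : 0 < ε) (N : ℕ) (B : ℝ≥0∞)
    (hB : ∀ P, IsCube P → truncIntegral w ε N P ≤ B * ∫⁻ y in P, ENNReal.ofReal (w y)) :
    truncIntegral w ε N Q ≤
      (2 ^ ε + (2 ^ n * 2) ^ ε * B * ENNReal.ofReal (1 - 1 / (2 * A))) *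
        ∫⁻ y in Q, ENNReal.ofReal (w y) := by
  have hm0 := hw.cubeMean_ne_zero hQ
  have hmt := hw.cubeMean_ne_top hQ
  have hmV := hQ.cubeMean_mul_volume w
  obtain ⟨S, hSc, hSd, hS, hout⟩ := hw.exists_calderonZygmund hQ (t := 2 * cubeMean w Q) (by
    rw [mul_assoc, hmV]
    exact le_mul_of_one_le_left' one_le_two)
  set O := ⋃ P ∈ S, P with hOdef
  have hOm : MeasurableSet O := MeasurableSet.biUnion hSc fun P hP => (hS P hP).1.measurableSet
  have hOQ : O ⊆ Q := iUnion₂_subset fun P hP => (hS P hP).2.1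
  have hsum : ∀ f : (Fin n → ℝ) → ℝ≥0∞, ∫⁻ y in O, f y = ∑' P : S, ∫⁻ y in (P : Set _), f y :=
    lintegral_biUnion hSc (fun P hP => (hS P hP).1.measurableSet) hSd
  have hOvol : 2 * cubeMean w Q * volume O ≤ ∫⁻ z in O, ENNReal.ofReal (w z) := by
    have hOv : volume O = ∑' P : S, volume (P : Set (Fin n → ℝ)) :=
      measure_biUnion hSc hSd fun P hP => (hS P hP).1.measurableSet
    rw [hsum, hOv, ← ENNReal.tsum_mul_left]
    exact ENNReal.tsum_le_tsum fun P => (hS P P.2).2.2.1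
  have hmass := lintegral_le_of_calderonZygmund hw hA1 hQ hA hOQ hOm hOvol
  have hinside : ∫⁻ y in O, ENNReal.ofReal (w y) *
      min ((ENNReal.ofReal (w y) / cubeMean w Q) ^ ε) N ≤
      (2 ^ n * 2) ^ ε * B * ∫⁻ z in O, ENNReal.ofReal (w z) := by
    rw [hsum, hsum, ← ENNReal.tsum_mul_left]
    refine ENNReal.tsum_le_tsum fun ⟨P, hPS⟩ => ?_
    obtain ⟨hP, -, -, hPle⟩ := hS P hPS
    have hPm : cubeMean w P ≤ 2 ^ n * 2 * cubeMean w Q := by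
      refine ENNReal.div_le_of_le_mul (hPle.trans_eq ?_)
      ring
    have hPm0 := hw.cubeMean_ne_zero hP
    have hPmt := hw.cubeMean_ne_top hP
    have hc1 : (1 : ℝ≥0∞) ≤ (2 ^ n * 2) ^ ε :=
      ENNReal.one_le_rpow (one_le_mul (one_le_pow₀ one_le_two) one_le_two) hε
    have hct : ((2 : ℝ≥0∞) ^ n * 2) ^ ε ≠ ∞ :=
      ENNReal.rpow_ne_top_of_nonneg hε.le (by finiteness)
    calc ∫⁻ y in P, ENNReal.ofReal (w y) * min ((ENNReal.ofReal (w y) / cubeMean w Q) ^ ε) N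
        ≤ ∫⁻ y in P, (2 ^ n * 2) ^ ε * (ENNReal.ofReal (w y) *
            min ((ENNReal.ofReal (w y) / cubeMean w P) ^ ε) N) := by
          refine lintegral_mono fun y => ?_
          rw [mul_left_comm]
          refine mul_le_mul_right ?_ _
          rw [mul_min]
          refine min_le_min ?_ (le_mul_of_one_le_left' hc1)
          rw [← ENNReal.mul_rpow_of_nonneg _ _ hε.le]
          refine ENNReal.rpow_le_rpow ?_ hε.le
          rw [ENNReal.div_le_iff hm0 hmt]
          calc ENNReal.ofReal (w y)
              = ENNReal.ofReal (w y) / cubeMean w P * cubeMean w P :=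
                (ENNReal.div_mul_cancel hPm0 hPmt).symm
            _ ≤ ENNReal.ofReal (w y) / cubeMean w P * (2 ^ n * 2 * cubeMean w Q) := by gcongr
            _ = _ := by ring
      _ = (2 ^ n * 2) ^ ε * truncIntegral w ε N P := lintegral_const_mul' _ _ hct
      _ ≤ (2 ^ n * 2) ^ ε * B * ∫⁻ z in P, ENNReal.ofReal (w z) := by
          rw [mul_assoc]
          gcongr
          exact hB P hP
  have houtside : ∫⁻ y in Q \ O, ENNReal.ofReal (w y) *
      min ((ENNReal.ofReal (w y) / cubeMean w Q) ^ ε) N ≤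
      2 ^ ε * ∫⁻ z in Q, ENNReal.ofReal (w z) := by
    rw [← lintegral_const_mul' _ _ (ENNReal.rpow_ne_top_of_nonneg hε.le (by finiteness))]
    refine le_trans ?_ (lintegral_mono_set (sdiff_subset (t := O)))
    refine lintegral_mono_ae ?_
    filter_upwards [ae_restrict_of_ae hout, ae_restrict_mem (hQ.measurableSet.diff hOm)]
      with y hy hyQ
    rw [mul_comm]
    gcongr
    refine (min_le_left _ _).trans (ENNReal.rpow_le_rpow ?_ hε.le)
    exact ENNReal.div_le_of_le_mul (hy hyQ.1 hyQ.2)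
  have hsplit := lintegral_inter_add_sdiff (μ := volume) (fun y => ENNReal.ofReal (w y) *
      min ((ENNReal.ofReal (w y) / cubeMean w Q) ^ ε) N) Q hOm
  rw [inter_eq_self_of_subset_right hOQ] at hsplit
  rw [truncIntegral, ← hsplit, add_mul, add_comm, mul_assoc _ (ENNReal.ofReal _)]
  gcongr
  exact hinside.trans (by gcongr)

/-- Higher integrability (Gehring's lemma) for `A₁` weights. -/
lemma MuckenhouptA1.exists_reverseHolder {n : ℕ} {w : (Fin n → ℝ) → ℝ} (hw : MuckenhouptA1 w) :
    ∃ ε : ℝ, 0 < ε ∧ ∃ B : ℝ≥0∞, B ≠ ∞ ∧ ∀ Q : Set (Fin n → ℝ), IsCube Q →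
      ∫⁻ y in Q, ENNReal.ofReal (w y) * (ENNReal.ofReal (w y) / cubeMean w Q) ^ ε ≤
        B * ∫⁻ y in Q, ENNReal.ofReal (w y) := by
  obtain ⟨A, hA1, hA⟩ := hw.exists_ae_le
  have hw := hw.1
  obtain ⟨ε, hε1, hε⟩ : ∃ ε : ℝ, (2 ^ n * 2 : ℝ) ^ ε * (1 - 1 / (2 * A)) < 1 ∧ 0 < ε := by
    have hcont : ContinuousAt (fun ε : ℝ => (2 ^ n * 2 : ℝ) ^ ε * (1 - 1 / (2 * A))) 0 :=
      (Real.continuousAt_const_rpow (by positivity)).mul continuousAt_const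
    have hlt : (2 ^ n * 2 : ℝ) ^ (0 : ℝ) * (1 - 1 / (2 * A)) < 1 := by
      have : 0 < 1 / (2 * A) := by positivity
      rw [Real.rpow_zero]
      linarith
    have := (hcont.eventually (gt_mem_nhds hlt)).filter_mono (nhdsWithin_le_nhds (s := Ioi 0))
    exact (this.and self_mem_nhdsWithin).exists
  set ρ : ℝ≥0∞ := (2 ^ n * 2) ^ ε * ENNReal.ofReal (1 - 1 / (2 * A)) with hρ
  have hρ1 : ρ < 1 := by
    have h1 : ((2 : ℝ≥0∞) ^ n * 2) ^ ε = ENNReal.ofReal ((2 ^ n * 2 : ℝ) ^ ε) := by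
      rw [← ENNReal.ofReal_rpow_of_pos (by positivity), ENNReal.ofReal_mul (by positivity),
        ENNReal.ofReal_pow (by positivity), ENNReal.ofReal_ofNat]
    rw [hρ, h1, ← ENNReal.ofReal_mul (by positivity), ← ENNReal.ofReal_one]
    exact (ENNReal.ofReal_lt_ofReal_iff one_pos).2 hε1
  have h2t : (2 : ℝ≥0∞) ^ ε ≠ ∞ := ENNReal.rpow_ne_top_of_nonneg hε.le (by finiteness)
  refine ⟨ε, hε, 2 ^ ε / (1 - ρ), ENNReal.div_ne_top h2t (tsub_pos_of_lt hρ1).ne', ?_⟩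
  have htrunc : ∀ (N : ℕ) (Q : Set (Fin n → ℝ)), IsCube Q →
      truncIntegral w ε N Q ≤ 2 ^ ε / (1 - ρ) * ∫⁻ y in Q, ENNReal.ofReal (w y) := by
    intro N
    let s : ℝ≥0∞ := ⨆ (Q : Set (Fin n → ℝ)) (_ : IsCube Q),
      truncIntegral w ε N Q / ∫⁻ y in Q, ENNReal.ofReal (w y)
    have hs : ∀ Q, IsCube Q → truncIntegral w ε N Q ≤ s * ∫⁻ y in Q, ENNReal.ofReal (w y) :=
      fun Q hQ => (ENNReal.div_le_iff (hw.lintegral_cube_ne_zero hQ)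
        (hQ.lintegral_ne_top hw.1)).1
        (le_iSup₂ (f := fun (Q : Set (Fin n → ℝ)) (_ : IsCube Q) =>
          truncIntegral w ε N Q / ∫⁻ y in Q, ENNReal.ofReal (w y)) Q hQ)
    have hst : s ≠ ∞ := by
      refine ne_top_of_le_ne_top (ENNReal.natCast_ne_top N) (iSup₂_le fun Q hQ => ?_)
      refine ENNReal.div_le_of_le_mul ?_
      rw [← lintegral_const_mul' _ _ (ENNReal.natCast_ne_top N)]
      refine lintegral_mono fun y => ?_
      rw [mul_comm]
      gcongr
      exact min_le_right _ _
    have hstep : s ≤ 2 ^ ε + ρ * s := by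
      refine iSup₂_le fun Q hQ => ENNReal.div_le_of_le_mul ?_
      refine (truncIntegral_le hw hA1 hQ (hA Q hQ) hε N s hs).trans_eq ?_
      rw [hρ]
      ring
    have hs' : s ≤ 2 ^ ε / (1 - ρ) := by
      rw [ENNReal.le_div_iff_mul_le (.inl (tsub_pos_of_lt hρ1).ne') (.inl (by finiteness)),
        mul_comm, ENNReal.sub_mul (fun _ _ => hst), one_mul]
      exact tsub_le_iff_right.2 hstep
    exact fun Q hQ => (hs Q hQ).trans (by gcongr)
  intro Q hQ
  have hmeas : AEMeasurable (fun y => ENNReal.ofReal (w y)) (volume.restrict Q) :=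
    (hQ.integrableOn hw.1).1.aemeasurable.ennreal_ofReal
  have hsup : ∀ u x : ℝ≥0∞, x * u = ⨆ N : ℕ, x * min u N := fun u x => by
    rw [← ENNReal.mul_iSup, ← inf_iSup_eq, ENNReal.iSup_natCast, inf_top_eq]
  have hmeasN : ∀ N : ℕ, AEMeasurable (fun y => ENNReal.ofReal (w y) *
      min ((ENNReal.ofReal (w y) / cubeMean w Q) ^ ε) N) (volume.restrict Q) := fun N =>
    hmeas.mul (((hmeas.div_const _).pow_const ε).min aemeasurable_const)
  rw [lintegral_congr fun y => hsup _ _, lintegral_iSup' hmeasN]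
  · exact iSup_le fun N => htrunc N Q hQ
  · refine ae_of_all _ fun y N M hNM => ?_
    simp only
    gcongr

/-- For an `A₁` weight, almost every point satisfies the `A₁` bound on all cubes containing it. -/
lemma MuckenhouptA1.exists_ae_cubeMean_le {n : ℕ} {w : (Fin n → ℝ) → ℝ} (hw : MuckenhouptA1 w) :
    ∃ A : ℝ, 1 ≤ A ∧ ∀ᵐ x, ∀ Q : Set (Fin n → ℝ), IsCube Q → x ∈ Q →
      cubeMean w Q ≤ ENNReal.ofReal A * ENNReal.ofReal (w x) := by
  obtain ⟨A, hA1, hA⟩ := hw.exists_ae_le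
  refine ⟨A, hA1, ?_⟩
  filter_upwards [hw.1.ae_tendsto_average] with x hx Q hQ hxQ
  have hae := hA Q hQ
  have hQ' := hQ
  obtain ⟨a, h, hh, rfl⟩ := hQ'
  have h0 : Tendsto (fun k : ℕ => 1 / ((k : ℝ) + 1)) atTop (𝓝 0) :=
    tendsto_one_div_add_atTop_nhds_zero_nat
  have hlim := hx (fun _ => x) _ (fun k => by positivity) h0
    (fun k i => ⟨le_rfl, by simp; positivity⟩)
  refine ge_of_tendsto (ENNReal.Tendsto.const_mul hlim (.inr (by finiteness))) ?_
  have hsub : ∀ᶠ k : ℕ in atTop, ∀ i, 1 / ((k : ℝ) + 1) < a i + h - x i :=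
    eventually_all.2 fun i => h0.eventually (gt_mem_nhds (by linarith [(hxQ i).2]))
  filter_upwards [hsub] with k hk
  have hcube : IsCube (cube n x (1 / ((k : ℝ) + 1))) := isCube_cube n x (by positivity)
  have hss : cube n x (1 / ((k : ℝ) + 1)) ⊆ cube n a h := fun y hy i =>
    ⟨(hxQ i).1.trans (hy i).1, by linarith [(hy i).2, hk i]⟩
  rw [← mul_div_assoc, ENNReal.le_div_iff_mul_le (.inl hcube.volume_ne_zero)
    (.inl hcube.volume_ne_top), ← setLIntegral_const, ← lintegral_const_mul' _ _ (by finiteness)]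
  refine lintegral_mono_ae ?_
  filter_upwards [ae_restrict_of_ae_restrict_of_subset hss hae] with y hy
  exact ENNReal.div_le_of_le_mul hy

lemma logPlus_nonneg (t : ℝ) : 0 ≤ logPlus t := le_max_left _ _

lemma rpow_le_rpow_mul_logPlus {r δ t : ℝ} (hδ : 0 ≤ δ) (ht : 0 ≤ t) :
    t ^ r ≤ t ^ r * (1 + logPlus t) ^ δ :=
  le_mul_of_one_le_right (by positivity)
    (Real.one_le_rpow (by linarith [logPlus_nonneg t]) hδ)

lemma exists_rpow_mul_logPlus_le {r δ ε : ℝ} (hr : 0 < r) (hδ : 0 ≤ δ) (hε : 0 < ε) :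
    ∃ C : ℝ, 0 ≤ C ∧ ∀ t : ℝ, 0 ≤ t →
      t ^ r * (1 + logPlus t) ^ δ ≤ C * (t ^ r + (t ^ r) ^ (1 + ε)) := by
  set η : ℝ := r * ε / (δ + 1) with hη
  have hη0 : 0 < η := by positivity
  have hηδ : η * δ ≤ r * ε := by
    rw [hη, div_mul_eq_mul_div, div_le_iff₀ (by positivity)]
    nlinarith [mul_pos hr hε]
  have hC1 : 1 ≤ (1 + 1 / η) ^ δ := Real.one_le_rpow (by simp; positivity) hδ
  refine ⟨(1 + 1 / η) ^ δ, by positivity, fun t ht => ?_⟩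
  rcases le_total t 1 with h1 | h1
  · have h2 : logPlus t = 0 := max_eq_left (Real.log_nonpos ht h1)
    rw [h2, add_zero, Real.one_rpow, mul_one]
    calc t ^ r ≤ t ^ r + (t ^ r) ^ (1 + ε) := le_add_of_nonneg_right (by positivity)
      _ ≤ _ := le_mul_of_one_le_left (by positivity) hC1
  · have ht0 : 0 < t := by linarith
    have h2 : logPlus t = Real.log t := max_eq_right (Real.log_nonneg h1)
    have h3 : 1 + logPlus t ≤ (1 + 1 / η) * t ^ η := by
      have h4 := Real.log_le_rpow_div ht hη0
      have h5 : 1 ≤ t ^ η := Real.one_le_rpow h1 hη0.le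
      rw [h2, add_mul, one_mul, div_mul_eq_mul_div, one_mul]
      linarith
    calc t ^ r * (1 + logPlus t) ^ δ ≤ t ^ r * ((1 + 1 / η) * t ^ η) ^ δ := by
          have := logPlus_nonneg t
          gcongr
      _ = (1 + 1 / η) ^ δ * (t ^ r * t ^ (η * δ)) := by
          rw [Real.mul_rpow (by positivity) (by positivity), ← Real.rpow_mul ht]
          ring
      _ ≤ (1 + 1 / η) ^ δ * (t ^ r * t ^ (r * ε)) := by
          gcongr
      _ = (1 + 1 / η) ^ δ * (t ^ r) ^ (1 + ε) := by
          rw [← Real.rpow_add ht0, ← Real.rpow_mul ht]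
          ring_nf
      _ ≤ _ := by
          gcongr
          exact le_add_of_nonneg_left (by positivity)

lemma ofReal_div_rpow {x l r : ℝ} (hx : 0 < x) (hl : 0 < l) :
    ENNReal.ofReal ((|x| / l) ^ r) = ENNReal.ofReal (x ^ r) / ENNReal.ofReal (l ^ r) := by
  rw [abs_of_pos hx, Real.div_rpow hx.le hl.le, ENNReal.ofReal_div_of_pos (by positivity)]

/-- A reverse Hölder bound controls the integral of the Young function on every cube. -/
lemma lintegral_rpow_mul_logPlus_le {n : ℕ} {r δ ε C : ℝ} (hε : 0 < ε) (hC0 : 0 ≤ C)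
    (hC : ∀ t : ℝ, 0 ≤ t → t ^ r * (1 + logPlus t) ^ δ ≤ C * (t ^ r + (t ^ r) ^ (1 + ε)))
    {v : (Fin n → ℝ) → ℝ} (hv : IsWeight v) (hw : IsWeight fun x => v x ^ r)
    {Q : Set (Fin n → ℝ)} (hQ : IsCube Q) {B : ℝ≥0∞}
    (hB : ∫⁻ y in Q, ENNReal.ofReal (v y ^ r) *
        (ENNReal.ofReal (v y ^ r) / cubeMean (fun x => v x ^ r) Q) ^ ε ≤
      B * ∫⁻ y in Q, ENNReal.ofReal (v y ^ r)) {l : ℝ} (hl : 0 < l) :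
    ∫⁻ y in Q, ENNReal.ofReal ((|v y| / l) ^ r * (1 + logPlus (|v y| / l)) ^ δ) ≤
      ENNReal.ofReal C * (cubeMean (fun x => v x ^ r) Q / ENNReal.ofReal (l ^ r) +
        B * (cubeMean (fun x => v x ^ r) Q / ENNReal.ofReal (l ^ r)) ^ (1 + ε)) * volume Q := by
  have hm0 := hw.cubeMean_ne_zero hQ
  have hmt := hw.cubeMean_ne_top hQ
  have hmV := hQ.cubeMean_mul_volume fun x => v x ^ r
  have hmeas : AEMeasurable (fun y => ENNReal.ofReal (v y ^ r)) (volume.restrict Q) :=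
    (hQ.integrableOn hw.1).1.aemeasurable.ennreal_ofReal
  set m := cubeMean (fun x => v x ^ r) Q
  have hL0 : ENNReal.ofReal (l ^ r) ≠ 0 := by simpa using Real.rpow_pos_of_pos hl r
  set L := ENNReal.ofReal (l ^ r)
  have hmL : m / L ≠ ∞ := ENNReal.div_ne_top hmt hL0
  have hpow : ∀ W : ℝ≥0∞, (W / L) ^ (1 + ε) =
      (m / L) ^ (1 + ε) * m⁻¹ * (W * (W / m) ^ ε) := fun W => by
    have h1 : W / L = W / m * (m / L) := by
      rw [← mul_div_assoc, ENNReal.div_mul_cancel hm0 hmt]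
    rw [h1, ENNReal.mul_rpow_of_nonneg _ _ (by positivity),
      ENNReal.rpow_add_of_nonneg (x := W / m) 1 ε zero_le_one hε.le, ENNReal.rpow_one]
    nth_rewrite 1 [div_eq_mul_inv W m]
    ring
  have hκ : (m / L) ^ (1 + ε) * m⁻¹ ≠ ∞ :=
    ENNReal.mul_ne_top (ENNReal.rpow_ne_top_of_nonneg (by positivity) hmL)
      (ENNReal.inv_ne_top.2 hm0)
  calc ∫⁻ y in Q, ENNReal.ofReal ((|v y| / l) ^ r * (1 + logPlus (|v y| / l)) ^ δ)
      ≤ ∫⁻ y in Q, ENNReal.ofReal C * (ENNReal.ofReal (v y ^ r) * L⁻¹ +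
          (m / L) ^ (1 + ε) * m⁻¹ * (ENNReal.ofReal (v y ^ r) *
            (ENNReal.ofReal (v y ^ r) / m) ^ ε)) := by
        refine lintegral_mono_ae (ae_restrict_of_ae ?_)
        filter_upwards [hv.2] with y hy
        refine (ENNReal.ofReal_le_ofReal (hC _ (by positivity))).trans_eq ?_
        rw [ENNReal.ofReal_mul hC0, ENNReal.ofReal_add (by positivity) (by positivity),
          ← ENNReal.ofReal_rpow_of_nonneg (x := (|v y| / l) ^ r) (by positivity) (by positivity),
          ofReal_div_rpow hy hl, hpow, div_eq_mul_inv _ L]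
    _ = ENNReal.ofReal C * ((∫⁻ y in Q, ENNReal.ofReal (v y ^ r)) * L⁻¹ +
          (m / L) ^ (1 + ε) * m⁻¹ * ∫⁻ y in Q, (ENNReal.ofReal (v y ^ r) *
            (ENNReal.ofReal (v y ^ r) / m) ^ ε)) := by
        rw [lintegral_const_mul' _ _ (by finiteness), lintegral_add_left' (hmeas.mul_const _),
          lintegral_mul_const' _ _ (ENNReal.inv_ne_top.2 hL0), lintegral_const_mul' _ _ hκ]
    _ ≤ ENNReal.ofReal C * ((m * volume Q) * L⁻¹ +
          (m / L) ^ (1 + ε) * m⁻¹ * (B * (m * volume Q))) := by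
        rw [hmV]
        gcongr
    _ = ENNReal.ofReal C * ((m * volume Q) * L⁻¹ +
          (m / L) ^ (1 + ε) * (m⁻¹ * m) * (B * volume Q)) := by ring
    _ = _ := by
        rw [ENNReal.inv_mul_cancel hm0 hmt, div_eq_mul_inv]
        ring

lemma integral_rpow_mul_logPlus {n : ℕ} {r δ : ℝ} {v : (Fin n → ℝ) → ℝ}
    (hv : IsWeight v) {Q : Set (Fin n → ℝ)} (hQ : IsCube Q) {l : ℝ} (hl : 0 < l) :
    ∫ y in Q, (|v y| / l) ^ r * (1 + logPlus (|v y| / l)) ^ δ =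
      (∫⁻ y in Q, ENNReal.ofReal
        ((|v y| / l) ^ r * (1 + logPlus (|v y| / l)) ^ δ)).toReal := by
  refine integral_eq_lintegral_of_nonneg_ae (ae_of_all _ fun y => ?_) ?_
  · have := logPlus_nonneg (|v y| / l)
    simp only [Pi.zero_apply]
    positivity
  · have h1 : Measurable fun z : ℝ => (|z| / l) ^ r * (1 + logPlus (|z| / l)) ^ δ := by
      unfold logPlus
      fun_prop
    exact (h1.comp_aemeasurable (hQ.integrableOn hv.1).1.aemeasurable).aestronglyMeasurable

/-- If `v^r ∈ A₁`, the Luxemburg average of `v` is comparable to the `r`-mean of `v`. -/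
lemma exists_luxNorm_comparable {n : ℕ} {r δ : ℝ} (hr : 0 < r) (hδ : 0 ≤ δ)
    {v : (Fin n → ℝ) → ℝ} (hv : IsWeight v) (hvr : MuckenhouptA1 fun x => v x ^ r) :
    ∃ c : ℝ, 1 ≤ c ∧ ∀ Q : Set (Fin n → ℝ), IsCube Q →
      cubeMean (fun x => v x ^ r) Q ^ (1 / r) ≤
        ENNReal.ofReal (luxNorm (fun z => z ^ r * (1 + logPlus z) ^ δ) v Q) ∧
      ENNReal.ofReal (luxNorm (fun z => z ^ r * (1 + logPlus z) ^ δ) v Q) ≤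
        (ENNReal.ofReal c * cubeMean (fun x => v x ^ r) Q) ^ (1 / r) := by
  obtain ⟨ε, hε, B, hBt, hB⟩ := hvr.exists_reverseHolder
  obtain ⟨C, hC0, hC⟩ := exists_rpow_mul_logPlus_le hr hδ hε
  have hw := hvr.1
  lift B to NNReal using hBt
  refine ⟨1 + C * (1 + B), by linarith [show 0 ≤ C * (1 + B) by positivity], fun Q hQ => ?_⟩
  have hm0 := hw.cubeMean_ne_zero hQ
  have hmt := hw.cubeMean_ne_top hQ
  have hmV := hQ.cubeMean_mul_volume fun x => v x ^ r
  have hVt := hQ.volume_ne_top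
  have hbound := fun (l : ℝ) (hl : 0 < l) =>
    lintegral_rpow_mul_logPlus_le hε hC0 hC hv hw hQ (hB Q hQ) hl
  set m := cubeMean (fun x => v x ^ r) Q
  set c : ℝ≥0∞ := ENNReal.ofReal (1 + C * (1 + B)) with hc
  have hc1 : 1 ≤ c := by
    rw [hc, ENNReal.one_le_ofReal]
    linarith [show 0 ≤ C * (1 + B) by positivity]
  have hct : c ≠ ∞ := ENNReal.ofReal_ne_top
  have hcC : ENNReal.ofReal C * (1 + B) ≤ c := by
    rw [← ENNReal.ofReal_coe_nnreal, ← ENNReal.ofReal_one, ← ENNReal.ofReal_add zero_le_one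
      B.coe_nonneg, ← ENNReal.ofReal_mul hC0]
    exact ENNReal.ofReal_le_ofReal (by linarith)
  have hcmt : (c * m) ^ (1 / r) ≠ ∞ :=
    ENNReal.rpow_ne_top_of_nonneg (by positivity) (by finiteness)
  have hcm0 : (c * m) ^ (1 / r) ≠ 0 := by
    rw [Ne, ENNReal.rpow_eq_zero_iff_of_pos (by positivity)]
    exact mul_ne_zero (one_pos.trans_le hc1).ne' hm0
  have hmem : ((c * m) ^ (1 / r)).toReal ∈ {l : ℝ | 0 < l ∧
      ∫ y in Q, (|v y| / l) ^ r * (1 + logPlus (|v y| / l)) ^ δ ≤ (volume Q).toReal} := by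
    have hl := ENNReal.toReal_pos hcm0 hcmt
    refine ⟨hl, ?_⟩
    rw [integral_rpow_mul_logPlus hv hQ hl]
    refine ENNReal.toReal_mono hVt ((hbound _ hl).trans ?_)
    have hL : ENNReal.ofReal (((c * m) ^ (1 / r)).toReal ^ r) = c * m := by
      rw [← ENNReal.ofReal_rpow_of_pos hl, ENNReal.ofReal_toReal hcmt, ← ENNReal.rpow_mul,
        one_div_mul_cancel hr.ne', ENNReal.rpow_one]
    have hτ : m / (c * m) = c⁻¹ := by
      rw [mul_comm c, ENNReal.div_eq_inv_mul, ENNReal.mul_inv (.inl hm0) (.inl hmt), mul_right_comm,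
        ENNReal.inv_mul_cancel hm0 hmt, one_mul]
    rw [hL, hτ]
    have hτ1 : c⁻¹ ^ (1 + ε) ≤ c⁻¹ := by
      conv_rhs => rw [← ENNReal.rpow_one c⁻¹]
      exact ENNReal.rpow_le_rpow_of_exponent_ge (ENNReal.inv_le_one.2 hc1) (by linarith)
    calc ENNReal.ofReal C * (c⁻¹ + B * c⁻¹ ^ (1 + ε)) * volume Q
        ≤ ENNReal.ofReal C * (c⁻¹ + B * c⁻¹) * volume Q := by gcongr
      _ = ENNReal.ofReal C * (1 + B) * c⁻¹ * volume Q := by ring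
      _ ≤ c * c⁻¹ * volume Q := by gcongr
      _ = volume Q := by
          rw [ENNReal.mul_inv_cancel (one_pos.trans_le hc1).ne' hct, one_mul]
  constructor
  · have hXt : m ^ (1 / r) ≠ ∞ := ENNReal.rpow_ne_top_of_nonneg (by positivity) hmt
    rw [← ENNReal.ofReal_toReal hXt]
    refine ENNReal.ofReal_le_ofReal (le_csInf ⟨_, hmem⟩ ?_)
    rintro l ⟨hl, hle⟩
    have hL0 : ENNReal.ofReal (l ^ r) ≠ 0 := by simpa using Real.rpow_pos_of_pos hl r
    have hfin : ∫⁻ y in Q, ENNReal.ofReal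
        ((|v y| / l) ^ r * (1 + logPlus (|v y| / l)) ^ δ) ≠ ∞ := by
      refine ne_top_of_le_ne_top ?_ (hbound l hl)
      have h1 : m / ENNReal.ofReal (l ^ r) ≠ ∞ := ENNReal.div_ne_top hmt hL0
      have h2 := ENNReal.rpow_ne_top_of_nonneg (y := 1 + ε) (by positivity) h1
      finiteness
    rw [integral_rpow_mul_logPlus hv hQ hl, ENNReal.toReal_le_toReal hfin hVt] at hle
    have h1 : m / ENNReal.ofReal (l ^ r) * volume Q ≤ 1 * volume Q := by
      rw [one_mul]
      refine le_trans ?_ hle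
      rw [div_eq_mul_inv, mul_right_comm, hmV,
        ← lintegral_mul_const' _ _ (ENNReal.inv_ne_top.2 hL0)]
      refine lintegral_mono_ae (ae_restrict_of_ae ?_)
      filter_upwards [hv.2] with y hy
      rw [← div_eq_mul_inv, ← ofReal_div_rpow hy hl]
      exact ENNReal.ofReal_le_ofReal (rpow_le_rpow_mul_logPlus hδ (by positivity))
    have h2 : m ≤ ENNReal.ofReal (l ^ r) := by
      have h3 := (ENNReal.mul_le_mul_iff_left hQ.volume_ne_zero hVt).1 h1
      simpa using (ENNReal.div_le_iff hL0 (by finiteness)).1 h3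
    refine ENNReal.toReal_le_of_le_ofReal hl.le ?_
    rw [one_div, ENNReal.rpow_inv_le_iff hr, ENNReal.ofReal_rpow_of_pos hl]
    exact h2
  · rw [← ENNReal.ofReal_toReal hcmt]
    exact ENNReal.ofReal_le_ofReal (csInf_le ⟨0, fun l hl => hl.1.le⟩ hmem)

/-- If `v^r ∈ A₁` and `Φ(t) = t^r(1+log⁺ t)^δ` then `M_Φ v ≈ v` a.e. -/
theorem maximal_comparable_of_A1 {n : ℕ} (r δ : ℝ) (hr : 1 ≤ r) (hδ : 0 ≤ δ)
    (v : (Fin n → ℝ) → ℝ) (hv : IsWeight v)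
    (hvr : MuckenhouptA1 (fun x => v x ^ r)) :
    ∃ C > 0, ∀ᵐ x ∂(volume : Measure (Fin n → ℝ)),
      ENNReal.ofReal (v x) ≤ maximalOp (fun z => z ^ r * (1 + logPlus z) ^ δ) v x ∧
      maximalOp (fun z => z ^ r * (1 + logPlus z) ^ δ) v x ≤ ENNReal.ofReal (C * v x) := by
  have hr0 : 0 < r := by linarith
  obtain ⟨c, hc1, hc⟩ := exists_luxNorm_comparable (δ := δ) hr0 hδ hv hvr
  obtain ⟨A, hA1, hA⟩ := hvr.exists_ae_cubeMean_le
  have hroot : ∀ x, 0 < v x → ENNReal.ofReal (v x ^ r) ^ (1 / r) = ENNReal.ofReal (v x) :=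
    fun x hx => by
      rw [ENNReal.ofReal_rpow_of_pos (by positivity), ← Real.rpow_mul hx.le,
        mul_one_div_cancel hr0.ne', Real.rpow_one]
  refine ⟨(c * A) ^ (1 / r), by positivity, ?_⟩
  filter_upwards [hvr.1.ae_tendsto_average, hA, hv.2] with x hx hAx hvx
  constructor
  · have hlim := hx (fun _ => x) (fun k => 1 / ((k : ℝ) + 1)) (fun k => by positivity)
      tendsto_one_div_add_atTop_nhds_zero_nat (fun k i => ⟨le_rfl, by simp; positivity⟩)
    have hlim' := ((ENNReal.continuous_rpow_const (y := 1 / r)).tendsto _).comp hlim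
    rw [hroot x hvx] at hlim'
    refine le_of_tendsto' hlim' fun k => ?_
    have hcube : IsCube (cube n x (1 / ((k : ℝ) + 1))) := isCube_cube n x (by positivity)
    refine (hc _ hcube).1.trans (le_iSup₂ (f := fun (Q : Set (Fin n → ℝ))
      (_ : IsCube Q ∧ x ∈ Q) => ENNReal.ofReal (luxNorm _ v Q)) _ ⟨hcube, fun i => ⟨le_rfl, ?_⟩⟩)
    simp
    positivity
  · refine iSup₂_le fun Q ⟨hQ, hxQ⟩ => (hc Q hQ).2.trans ?_
    calc (ENNReal.ofReal c * cubeMean (fun x => v x ^ r) Q) ^ (1 / r)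
        ≤ (ENNReal.ofReal c * (ENNReal.ofReal A * ENNReal.ofReal (v x ^ r))) ^ (1 / r) := by
          gcongr
          exact hAx Q hQ hxQ
      _ = _ := by
          rw [← mul_assoc, ENNReal.mul_rpow_of_nonneg _ _ (by positivity), hroot x hvx,
            ← ENNReal.ofReal_mul (by positivity), ENNReal.ofReal_rpow_of_pos (by positivity),
            ENNReal.ofReal_mul (by positivity)]
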